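/- Fix x ∈ ℝ^n and a nonempty subset P ⊆ S. Assume Λ is nonempty and for each s ∈ P there exists y ∈ ℝ^m with y ≥ 0 and W y = h^s − T^s x (each scenario subproblem at x is feasible). Then each infimum Q(x, h^s, T^s) (s ∈ P) and the aggregated infimum Q(x, h^P, T^P) are finite, and Q(x, h^P, T^P) ≤ Σ_{s∈P} (p^s/p^P) Q(x, h^s, T^s). -/

import Mathlib

open Finset Matrix BigOperators

/-- Feasible objective values of the second-stage subproblem. -/
def secondStageValues {n m p : ℕ}
    (W : Matrix (Fin p) (Fin m) ℝ) (q : Fin m → ℝ)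
    (x : Fin n → ℝ) (h : Fin p → ℝ) (T : Matrix (Fin p) (Fin n) ℝ) : Set ℝ :=
  {v | ∃ y : Fin m → ℝ, 0 ≤ y ∧ W.mulVec y = h - T.mulVec x ∧ v = q ⬝ᵥ y}

/-- Second-stage value `Q(x, h, T) = inf {q·y : y ≥ 0, W y = h − T x}`. -/
noncomputable def secondStageValue {n m p : ℕ}
    (W : Matrix (Fin p) (Fin m) ℝ) (q : Fin m → ℝ)
    (x : Fin n → ℝ) (h : Fin p → ℝ) (T : Matrix (Fin p) (Fin n) ℝ) : ℝ :=
  sInf (secondStageValues W q x h T)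

theorem secondStageValues_bddBelow {n m p : ℕ}
    (W : Matrix (Fin p) (Fin m) ℝ) (q : Fin m → ℝ)
    (x : Fin n → ℝ) (h : Fin p → ℝ) (T : Matrix (Fin p) (Fin n) ℝ)
    (hΛ : ∃ lam : Fin p → ℝ, W.transpose.mulVec lam ≤ q) :
    BddBelow (secondStageValues W q x h T) := by
  obtain ⟨lam, hl⟩ := hΛ
  refine ⟨lam ⬝ᵥ (h - T.mulVec x), ?_⟩
  rintro v ⟨y, hy, hW, rfl⟩
  rw [← hW, Matrix.dotProduct_mulVec, ← Matrix.mulVec_transpose]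
  exact dotProduct_le_dotProduct_of_nonneg_right hl hy

theorem secondStageValues_aggregate {n m p : ℕ}
    (W : Matrix (Fin p) (Fin m) ℝ) (q : Fin m → ℝ)
    {S : Type*} (pr : S → ℝ) (hpr : ∀ s, 0 < pr s)
    (h : S → Fin p → ℝ) (T : S → Matrix (Fin p) (Fin n) ℝ)
    (P : Finset S) (x : Fin n → ℝ) (v : S → ℝ)
    (hv : ∀ s ∈ P, v s ∈ secondStageValues W q x (h s) (T s)) :
    ∑ s ∈ P, (pr s / ∑ t ∈ P, pr t) * v s ∈
      secondStageValues W q x ((∑ s ∈ P, pr s)⁻¹ • ∑ s ∈ P, pr s • h s)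
        ((∑ s ∈ P, pr s)⁻¹ • ∑ s ∈ P, pr s • T s) := by
  have hv' : ∀ s, ∃ y : Fin m → ℝ, s ∈ P →
      0 ≤ y ∧ W.mulVec y = h s - (T s).mulVec x ∧ v s = q ⬝ᵥ y := by
    intro s
    by_cases hs : s ∈ P
    · obtain ⟨y, hy⟩ := hv s hs
      exact ⟨y, fun _ => hy⟩
    · exact ⟨0, fun h => absurd h hs⟩
  choose y hy using hv'
  refine ⟨(∑ s ∈ P, pr s)⁻¹ • ∑ s ∈ P, pr s • y s, ?_, ?_, ?_⟩
  · exact smul_nonneg (inv_nonneg.2 (Finset.sum_nonneg fun s _ => (hpr s).le))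
      (Finset.sum_nonneg fun s hs => smul_nonneg (hpr s).le (hy s hs).1)
  · rw [Matrix.mulVec_smul, Matrix.smul_mulVec, ← smul_sub, Matrix.mulVec_sum,
      Matrix.sum_mulVec, ← Finset.sum_sub_distrib]
    congr 1
    refine Finset.sum_congr rfl fun s hs => ?_
    rw [Matrix.mulVec_smul, Matrix.smul_mulVec, ← smul_sub, (hy s hs).2.1]
  · rw [dotProduct_smul, dotProduct_sum, smul_eq_mul, Finset.mul_sum]
    refine Finset.sum_congr rfl fun s hs => ?_
    rw [dotProduct_smul, smul_eq_mul, (hy s hs).2.2]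
    ring

/-- **Jensen-type lower bound.** If `Λ ≠ ∅` and each scenario subproblem on `P`
is feasible at `x`, then all the relevant infima are finite and the aggregated
subproblem value is at most the weighted average of the scenario values:
`Q(x, h^P, T^P) ≤ ∑_{s∈P} (pˢ/p^P) Q(x, hˢ, Tˢ)`. -/
theorem aggregated_subproblem_le_average
    {n m p : ℕ} (W : Matrix (Fin p) (Fin m) ℝ) (q : Fin m → ℝ)
    {S : Type*} [Fintype S] (pr : S → ℝ) (hpr : ∀ s, 0 < pr s)
    (h : S → Fin p → ℝ) (T : S → Matrix (Fin p) (Fin n) ℝ)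
    (P : Finset S) (hPne : P.Nonempty)
    (x : Fin n → ℝ)
    (hΛ : ∃ lam : Fin p → ℝ, W.transpose.mulVec lam ≤ q)
    (hfeas : ∀ s ∈ P, ∃ y : Fin m → ℝ, 0 ≤ y ∧ W.mulVec y = h s - (T s).mulVec x) :
    (∀ s ∈ P, (secondStageValues W q x (h s) (T s)).Nonempty ∧
        BddBelow (secondStageValues W q x (h s) (T s))) ∧
    (secondStageValues W q x ((∑ s ∈ P, pr s)⁻¹ • ∑ s ∈ P, pr s • h s)
        ((∑ s ∈ P, pr s)⁻¹ • ∑ s ∈ P, pr s • T s)).Nonempty ∧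
    BddBelow (secondStageValues W q x ((∑ s ∈ P, pr s)⁻¹ • ∑ s ∈ P, pr s • h s)
        ((∑ s ∈ P, pr s)⁻¹ • ∑ s ∈ P, pr s • T s)) ∧
    secondStageValue W q x ((∑ s ∈ P, pr s)⁻¹ • ∑ s ∈ P, pr s • h s)
        ((∑ s ∈ P, pr s)⁻¹ • ∑ s ∈ P, pr s • T s)
      ≤ ∑ s ∈ P, (pr s / ∑ t ∈ P, pr t) * secondStageValue W q x (h s) (T s) := by
  have hne : ∀ s ∈ P, (secondStageValues W q x (h s) (T s)).Nonempty := by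
    intro s hs
    obtain ⟨y, h0, h1⟩ := hfeas s hs
    exact ⟨_, y, h0, h1, rfl⟩
  have hbdd := secondStageValues_bddBelow W q x
    ((∑ s ∈ P, pr s)⁻¹ • ∑ s ∈ P, pr s • h s)
    ((∑ s ∈ P, pr s)⁻¹ • ∑ s ∈ P, pr s • T s) hΛ
  have hpos : 0 < ∑ s ∈ P, pr s := Finset.sum_pos (fun s _ => hpr s) hPne
  have key : ∀ ε : ℝ, 0 < ε → ∃ v : S → ℝ, ∀ s ∈ P,
      v s ∈ secondStageValues W q x (h s) (T s) ∧
      v s ≤ secondStageValue W q x (h s) (T s) + ε := by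
    intro ε hε
    have : ∀ s, ∃ v : ℝ, s ∈ P → v ∈ secondStageValues W q x (h s) (T s) ∧
        v ≤ secondStageValue W q x (h s) (T s) + ε := by
      intro s
      by_cases hs : s ∈ P
      · obtain ⟨v, hv, hlt⟩ := Real.lt_sInf_add_pos (hne s hs) hε
        exact ⟨v, fun _ => ⟨hv, hlt.le⟩⟩
      · exact ⟨0, fun h => absurd h hs⟩
    choose v hv using this
    exact ⟨v, hv⟩
  refine ⟨fun s hs => ⟨hne s hs, secondStageValues_bddBelow W q x _ _ hΛ⟩, ?_, hbdd, ?_⟩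
  · obtain ⟨v, hv⟩ := key 1 one_pos
    exact ⟨_, secondStageValues_aggregate W q pr hpr h T P x v fun s hs => (hv s hs).1⟩
  · refine le_of_forall_pos_le_add fun ε hε => ?_
    obtain ⟨v, hv⟩ := key ε hε
    refine (csInf_le hbdd (secondStageValues_aggregate W q pr hpr h T P x v
      fun s hs => (hv s hs).1)).trans ?_
    calc ∑ s ∈ P, (pr s / ∑ t ∈ P, pr t) * v s
        ≤ ∑ s ∈ P, (pr s / ∑ t ∈ P, pr t) * (secondStageValue W q x (h s) (T s) + ε) :=
          Finset.sum_le_sum fun s hs =>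
            mul_le_mul_of_nonneg_left (hv s hs).2 (div_nonneg (hpr s).le hpos.le)
      _ = _ := by
          simp_rw [mul_add]
          rw [Finset.sum_add_distrib, ← Finset.sum_mul, ← Finset.sum_div,
            div_self hpos.ne', one_mul]
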